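/- Let X ⊆ ℝ^q be compact, γ > 0, and c : X × X → ℝ continuous with 0 ≤ c(x,y) ≤ M_c and G_c-Lipschitz in each variable. Let α, α', β be probability measures on X, and let (f, g) and (f', g') be continuous Sinkhorn potential pairs, i.e. g = A(f, α), f = A(g, β) and g' = A(f', α'), f' = A(g', β), normalized so that f(x₀) = f'(x₀) = 0 for some common x₀ ∈ X. Set λ := (exp(M_c/γ) − 1)/(exp(M_c/γ) + 1) and G_bl := 2γ · exp(2M_c/γ) · max{ exp(3M_c/γ), 2 G_c exp(3M_c/γ)/γ } / (1 − λ²). Then ‖f − f'‖∞ ≤ G_bl · d_bl(α, α') and ‖g − g'‖∞ ≤ G_bl · d_bl(α, α'). -/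

import Mathlib

open MeasureTheory

/-- The Sinkhorn mapping `A(f, α)(y) = -γ log ∫ exp((f x - c x y)/γ) dα(x)`. -/
noncomputable def sinkhornMap {q : ℕ} (γ : ℝ)
    (c : EuclideanSpace ℝ (Fin q) → EuclideanSpace ℝ (Fin q) → ℝ)
    (f : EuclideanSpace ℝ (Fin q) → ℝ)
    (α : Measure (EuclideanSpace ℝ (Fin q))) :
    EuclideanSpace ℝ (Fin q) → ℝ :=
  fun y => -γ * Real.log (∫ x, Real.exp ((f x - c x y) / γ) ∂α)

/-- The bounded-Lipschitz metric on measures supported in `X`. -/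
noncomputable def dblOn {q : ℕ} (X : Set (EuclideanSpace ℝ (Fin q)))
    (α α' : Measure (EuclideanSpace ℝ (Fin q))) : ℝ :=
  sSup {r : ℝ | ∃ ξ : EuclideanSpace ℝ (Fin q) → ℝ,
    (∀ x ∈ X, |ξ x| ≤ 1) ∧ LipschitzOnWith 1 ξ X ∧
    r = |(∫ x, ξ x ∂α) - (∫ x, ξ x ∂α')|}

theorem log_mul_exp_add_one_sub_log_add_exp_le {r δ : ℝ} (hr : 1 ≤ r) (hδ : 0 ≤ δ) :
    Real.log (r * Real.exp δ + 1) - Real.log (r + Real.exp δ) ≤ (r - 1) / (r + 1) * δ := by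
  have hr0 : 0 < r := by linarith
  let h : ℝ → ℝ := fun s =>
    (r - 1) / (r + 1) * s - (Real.log (r * Real.exp s + 1) - Real.log (r + Real.exp s))
  have hd (s : ℝ) : HasDerivAt h ((r - 1) / (r + 1) * 1 -
      (r * Real.exp s / (r * Real.exp s + 1) - Real.exp s / (r + Real.exp s))) s := by
    have hs := Real.exp_pos s
    have h₁ := (((Real.hasDerivAt_exp s).const_mul r).add_const 1).log (by positivity)
    have h₂ := ((Real.hasDerivAt_exp s).const_add r).log (by positivity)
    exact ((hasDerivAt_id s).const_mul ((r - 1) / (r + 1))).sub (h₁.sub h₂)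
  have hmono : Monotone h := by
    refine monotone_of_hasDerivAt_nonneg hd fun s => ?_
    have hs := Real.exp_pos s
    change 0 ≤ (r - 1) / (r + 1) * 1 -
      (r * Real.exp s / (r * Real.exp s + 1) - Real.exp s / (r + Real.exp s))
    generalize Real.exp s = e at hs
    have heq : (r - 1) / (r + 1) * 1 - (r * e / (r * e + 1) - e / (r + e)) =
        (r - 1) * r * (e - 1) ^ 2 / ((r + 1) * ((r * e + 1) * (r + e))) := by
      field_simp
      ring
    rw [heq]
    have := sub_nonneg.2 hr
    positivity
  have h0 : h 0 = 0 := by simp [h, add_comm]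
  have := hmono hδ
  rw [h0] at this
  simpa [h] using this

theorem abs_exp_sub_exp_le {a b M : ℝ} (ha : a ≤ M) (hb : b ≤ M) :
    |Real.exp a - Real.exp b| ≤ Real.exp M * |a - b| := by
  wlog hab : b ≤ a generalizing a b
  · rw [abs_sub_comm, abs_sub_comm a b]
    exact this hb ha (le_of_not_ge hab)
  rw [abs_of_nonneg (sub_nonneg.2 (Real.exp_le_exp.2 hab)), abs_of_nonneg (sub_nonneg.2 hab)]
  calc Real.exp a - Real.exp b = Real.exp a * (1 - Real.exp (b - a)) := by
        rw [mul_sub, ← Real.exp_add]; simp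
    _ ≤ Real.exp a * (a - b) := by
        refine mul_le_mul_of_nonneg_left ?_ (Real.exp_pos a).le
        linarith [Real.add_one_le_exp (b - a)]
    _ ≤ _ := mul_le_mul_of_nonneg_right (Real.exp_le_exp.2 ha) (sub_nonneg.2 hab)

theorem abs_log_sub_log_le {a b m : ℝ} (hm : 0 < m) (ha : m ≤ a) (hb : m ≤ b) :
    |Real.log a - Real.log b| ≤ m⁻¹ * |a - b| := by
  wlog hab : b ≤ a generalizing a b
  · rw [abs_sub_comm, abs_sub_comm a b]
    exact this hb ha (le_of_not_ge hab)
  have hb0 := hm.trans_le hb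
  have ha0 := hm.trans_le ha
  rw [abs_of_nonneg (sub_nonneg.2 (Real.log_le_log hb0 hab)), abs_of_nonneg (sub_nonneg.2 hab),
    ← Real.log_div ha0.ne' hb0.ne']
  calc Real.log (a / b) ≤ a / b - 1 := Real.log_le_sub_one_of_pos (by positivity)
    _ = b⁻¹ * (a - b) := by field_simp
    _ ≤ _ := mul_le_mul_of_nonneg_right (inv_anti₀ hm hb) (sub_nonneg.2 hab)

theorem one_sub_sq_le_sq_mul_one_sub_sq {t : ℝ} (ht : 1 ≤ t) :
    1 - ((t - 1) / (t + 1)) ^ 2 ≤ t ^ 2 * (1 - ((t ^ 2 - 1) / (t ^ 2 + 1)) ^ 2) := by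
  have ht0 : 0 < t := by linarith
  have h₁ : 1 - ((t - 1) / (t + 1)) ^ 2 = 4 * t / (t + 1) ^ 2 := by
    field_simp
    ring
  have h₂ : t ^ 2 * (1 - ((t ^ 2 - 1) / (t ^ 2 + 1)) ^ 2) = 4 * t ^ 4 / (t ^ 2 + 1) ^ 2 := by
    field_simp
    ring
  rw [h₁, h₂, div_le_div_iff₀ (by positivity) (by positivity)]
  have h₃ : (t ^ 2 + 1) ^ 2 ≤ (t ^ 2 + t) ^ 2 := by gcongr
  calc 4 * t * (t ^ 2 + 1) ^ 2 ≤ 4 * t * (t ^ 2 + t) ^ 2 := by gcongr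
    _ = 4 * t ^ 3 * (t + 1) ^ 2 * 1 := by ring
    _ ≤ 4 * t ^ 3 * (t + 1) ^ 2 * t := by gcongr
    _ = _ := by ring

theorem ae_mem_of_measure_compl_eq_zero {E : Type*} [MeasurableSpace E] {X : Set E} {μ : Measure E}
    (hμ : μ Xᶜ = 0) : ∀ᵐ x ∂μ, x ∈ X :=
  mem_ae_iff.2 hμ

theorem continuousOn_exp_div {E : Type*} [TopologicalSpace E] {X : Set E} {γ : ℝ} {u : E → ℝ}
    (hu : ContinuousOn u X) : ContinuousOn (fun x => Real.exp (u x / γ)) X :=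
  (hu.div_const γ).rexp

section Laplace

variable {E : Type*} [TopologicalSpace E] [MeasurableSpace E] [OpensMeasurableSpace E] [T2Space E]
  {X : Set E} {μ : Measure E}

theorem ContinuousOn.integrable_of_measure_compl_eq_zero [IsFiniteMeasure μ] (hX : IsCompact X)
    (hμ : μ Xᶜ = 0) {u : E → ℝ} (hu : ContinuousOn u X) : Integrable u μ := by
  have h := hu.integrableOn_compact (μ := μ) hX
  rwa [IntegrableOn, Measure.restrict_eq_self_of_ae_mem (ae_mem_of_measure_compl_eq_zero hμ)] at h

theorem integral_exp_div_pos [IsProbabilityMeasure μ] (hX : IsCompact X) (hμ : μ Xᶜ = 0)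
    {γ : ℝ} {u : E → ℝ} (hu : ContinuousOn u X) : 0 < ∫ x, Real.exp (u x / γ) ∂μ :=
  integral_exp_pos ((continuousOn_exp_div hu).integrable_of_measure_compl_eq_zero hX hμ)

/-- One-sided nonexpansiveness of `u ↦ γ log ∫ exp (u / γ)`. -/
theorem log_integral_exp_le_add [IsProbabilityMeasure μ] (hX : IsCompact X) (hμ : μ Xᶜ = 0)
    {γ : ℝ} (hγ : 0 < γ) {u v : E → ℝ} (hu : ContinuousOn u X) (hv : ContinuousOn v X) {s : ℝ}
    (huv : ∀ x ∈ X, u x ≤ v x + s) :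
    γ * Real.log (∫ x, Real.exp (u x / γ) ∂μ) ≤
      γ * Real.log (∫ x, Real.exp (v x / γ) ∂μ) + s := by
  have hle : ∫ x, Real.exp (u x / γ) ∂μ ≤
      Real.exp (s / γ) * ∫ x, Real.exp (v x / γ) ∂μ := by
    rw [← integral_const_mul]
    refine integral_mono_ae ((continuousOn_exp_div hu).integrable_of_measure_compl_eq_zero hX hμ)
      (((continuousOn_exp_div hv).integrable_of_measure_compl_eq_zero hX hμ).const_mul _) ?_
    filter_upwards [ae_mem_of_measure_compl_eq_zero hμ] with x hx
    rw [← Real.exp_add, ← add_div]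
    gcongr
    linarith [huv x hx]
  have hlog := Real.log_le_log (integral_exp_div_pos hX hμ hu) hle
  rw [Real.log_mul (Real.exp_pos _).ne' (integral_exp_div_pos hX hμ hv).ne', Real.log_exp] at hlog
  calc _ ≤ γ * (s / γ + Real.log (∫ x, Real.exp (v x / γ) ∂μ)) := by gcongr
    _ = _ := by field_simp; ring

theorem abs_log_integral_exp_sub_le [IsProbabilityMeasure μ] (hX : IsCompact X) (hμ : μ Xᶜ = 0)
    {γ : ℝ} (hγ : 0 < γ) {u v : E → ℝ} (hu : ContinuousOn u X) (hv : ContinuousOn v X) {s : ℝ}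
    (huv : ∀ x ∈ X, |u x - v x| ≤ s) :
    |-γ * Real.log (∫ x, Real.exp (u x / γ) ∂μ) - -γ * Real.log (∫ x, Real.exp (v x / γ) ∂μ)|
      ≤ s := by
  have h₁ := log_integral_exp_le_add hX hμ hγ hu hv (s := s)
    fun x hx => by linarith [(abs_le.1 (huv x hx)).2]
  have h₂ := log_integral_exp_le_add hX hμ hγ hv hu (s := s)
    fun x hx => by linarith [(abs_le.1 (huv x hx)).1]
  rw [abs_le]
  constructor <;> linarith

/-- Two-weight ratio inequality behind the projective contraction of positive kernels. -/
theorem integral_mul_integral_ratio_le [IsFiniteMeasure μ] (hX : IsCompact X) (hμ : μ Xᶜ = 0)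
    {p w w' : E → ℝ} (hp : ContinuousOn p X) (hw : ContinuousOn w X) (hw' : ContinuousOn w' X)
    {m M t : ℝ} (hm : 0 ≤ m) (hM : 0 ≤ M) (ht : 0 ≤ t)
    (hmp : ∀ x ∈ X, m ≤ p x) (hpM : ∀ x ∈ X, p x ≤ M)
    (hw0 : ∀ x ∈ X, 0 ≤ w x) (hw0' : ∀ x ∈ X, 0 ≤ w' x)
    (hww' : ∀ x ∈ X, w x ≤ t * w' x) (hw'w : ∀ x ∈ X, w' x ≤ t * w x) :
    (∫ x, p x * w x ∂μ) * (∫ x, w' x ∂μ) * (t ^ 2 * m + M) ≤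
      (∫ x, p x * w' x ∂μ) * (∫ x, w x ∂μ) * (t ^ 2 * M + m) := by
  have hX_ae := ae_mem_of_measure_compl_eq_zero hμ
  have iw := hw.integrable_of_measure_compl_eq_zero hX hμ
  have iw' := hw'.integrable_of_measure_compl_eq_zero hX hμ
  have ipw : Integrable (fun x => p x * w x) μ :=
    (hp.mul hw).integrable_of_measure_compl_eq_zero hX hμ
  have ipw' : Integrable (fun x => p x * w' x) μ :=
    (hp.mul hw').integrable_of_measure_compl_eq_zero hX hμ
  have hW : 0 ≤ ∫ x, w x ∂μ := integral_nonneg_of_ae (hX_ae.mono hw0)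
  have hW' : 0 ≤ ∫ x, w' x ∂μ := integral_nonneg_of_ae (hX_ae.mono hw0')
  have hWt : ∫ x, w x ∂μ ≤ t * ∫ x, w' x ∂μ := by
    rw [← integral_const_mul]
    exact integral_mono_ae iw (iw'.const_mul t) (hX_ae.mono hww')
  have upper : M * (∫ x, w' x ∂μ) - ∫ x, p x * w' x ∂μ ≤
      t * (M * (∫ x, w x ∂μ) - ∫ x, p x * w x ∂μ) := by
    rw [← integral_const_mul, ← integral_const_mul, ← integral_sub (iw'.const_mul M) ipw',
      ← integral_sub (iw.const_mul M) ipw, ← integral_const_mul]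
    refine integral_mono_ae ((iw'.const_mul M).sub ipw')
      (((iw.const_mul M).sub ipw).const_mul t) ?_
    filter_upwards [hX_ae] with x hx
    nlinarith [mul_le_mul_of_nonneg_left (hw'w x hx) (sub_nonneg.2 (hpM x hx))]
  have lower : (∫ x, p x * w x ∂μ) - m * (∫ x, w x ∂μ) ≤
      t * ((∫ x, p x * w' x ∂μ) - m * ∫ x, w' x ∂μ) := by
    rw [← integral_const_mul, ← integral_const_mul, ← integral_sub ipw (iw.const_mul m),
      ← integral_sub ipw' (iw'.const_mul m), ← integral_const_mul]
    refine integral_mono_ae (ipw.sub (iw.const_mul m))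
      ((ipw'.sub (iw'.const_mul m)).const_mul t) ?_
    filter_upwards [hX_ae] with x hx
    nlinarith [mul_le_mul_of_nonneg_left (hww' x hx) (sub_nonneg.2 (hmp x hx))]
  have hWt' : ∫ x, w' x ∂μ ≤ t * ∫ x, w x ∂μ := by
    rw [← integral_const_mul]
    exact integral_mono_ae iw' (iw.const_mul t) (hX_ae.mono hw'w)
  have hupper0 : 0 ≤ M * (∫ x, w x ∂μ) - ∫ x, p x * w x ∂μ := by
    rw [← integral_const_mul, sub_nonneg]
    refine integral_mono_ae ipw (iw.const_mul M) ?_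
    filter_upwards [hX_ae] with x hx
    exact mul_le_mul_of_nonneg_right (hpM x hx) (hw0 x hx)
  have hlower0 : 0 ≤ (∫ x, p x * w' x ∂μ) - m * ∫ x, w' x ∂μ := by
    rw [← integral_const_mul, sub_nonneg]
    refine integral_mono_ae (iw'.const_mul m) ipw' ?_
    filter_upwards [hX_ae] with x hx
    exact mul_le_mul_of_nonneg_right (hmp x hx) (hw0' x hx)
  generalize (∫ x, p x * w x ∂μ) = P at *
  generalize (∫ x, p x * w' x ∂μ) = P' at *
  generalize (∫ x, w x ∂μ) = W at *
  generalize (∫ x, w' x ∂μ) = W' at *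
  have h₁ : (M * W' - P') * W ≤ t ^ 2 * ((M * W - P) * W') := calc
    _ ≤ t * (M * W - P) * W := by gcongr
    _ ≤ t * (M * W - P) * (t * W') := by gcongr
    _ = _ := by ring
  have h₂ : (P - m * W) * W' ≤ t ^ 2 * ((P' - m * W') * W) := calc
    _ ≤ t * (P' - m * W') * W' := by gcongr
    _ ≤ t * (P' - m * W') * (t * W) := by gcongr
    _ = _ := by ring
  linarith [mul_le_mul_of_nonneg_left h₁ hm, mul_le_mul_of_nonneg_left h₂ hM]

/-- Contraction of oscillations under `f ↦ γ log ∫ exp ((f - k) / γ)`. -/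
theorem log_integral_exp_sub_sub_le [IsProbabilityMeasure μ] (hX : IsCompact X) (hμ : μ Xᶜ = 0)
    {γ : ℝ} (hγ : 0 < γ) {f f' k k' : E → ℝ} (hf : ContinuousOn f X) (hf' : ContinuousOn f' X)
    (hk : ContinuousOn k X) (hk' : ContinuousOn k' X) {L m δ : ℝ} (hL : 0 ≤ L) (hδ : 0 ≤ δ)
    (hkk' : ∀ x ∈ X, |k x - k' x| ≤ L) (hm : ∀ x ∈ X, m ≤ f x - f' x)
    (hmδ : ∀ x ∈ X, f x - f' x ≤ m + δ) :
    γ * (Real.log (∫ x, Real.exp ((f x - k x) / γ) ∂μ) -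
        Real.log (∫ x, Real.exp ((f' x - k x) / γ) ∂μ)) -
      γ * (Real.log (∫ x, Real.exp ((f x - k' x) / γ) ∂μ) -
        Real.log (∫ x, Real.exp ((f' x - k' x) / γ) ∂μ)) ≤
      (Real.exp (L / γ) ^ 2 - 1) / (Real.exp (L / γ) ^ 2 + 1) * δ := by
  have ht : 1 ≤ Real.exp (L / γ) := Real.one_le_exp (by positivity)
  have hratio := integral_mul_integral_ratio_le hX hμ (continuousOn_exp_div (γ := γ) (hf.sub hf'))
    (continuousOn_exp_div (γ := γ) (hf'.sub hk)) (continuousOn_exp_div (γ := γ) (hf'.sub hk'))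
    (Real.exp_pos (m / γ)).le (Real.exp_pos ((m + δ) / γ)).le (Real.exp_pos (L / γ)).le
    (fun x hx => Real.exp_le_exp.2 (by have := hm x hx; simp only [Pi.sub_apply]; gcongr))
    (fun x hx => Real.exp_le_exp.2 (by have := hmδ x hx; simp only [Pi.sub_apply]; gcongr))
    (fun x _ => (Real.exp_pos _).le) (fun x _ => (Real.exp_pos _).le)
    (fun x hx => by
      rw [← Real.exp_add, ← add_div]
      simp only [Pi.sub_apply]
      gcongr
      linarith [(abs_le.1 (hkk' x hx)).1])
    (fun x hx => by
      rw [← Real.exp_add, ← add_div]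
      simp only [Pi.sub_apply]
      gcongr
      linarith [(abs_le.1 (hkk' x hx)).2])
  have hmerge (l : E → ℝ) (x : E) : Real.exp ((f - f') x / γ) * Real.exp ((f' - l) x / γ) =
      Real.exp ((f x - l x) / γ) := by
    rw [← Real.exp_add, ← add_div]
    simp
  simp only [hmerge] at hratio
  simp only [Pi.sub_apply] at hratio
  have hP := integral_exp_div_pos hX hμ (γ := γ) (hf.sub hk)
  have hP' := integral_exp_div_pos hX hμ (γ := γ) (hf.sub hk')
  have hW := integral_exp_div_pos hX hμ (γ := γ) (hf'.sub hk)
  have hW' := integral_exp_div_pos hX hμ (γ := γ) (hf'.sub hk')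
  simp only [Pi.sub_apply] at hP hP' hW hW'
  generalize (∫ x, Real.exp ((f x - k x) / γ) ∂μ) = P at *
  generalize (∫ x, Real.exp ((f x - k' x) / γ) ∂μ) = P' at *
  generalize (∫ x, Real.exp ((f' x - k x) / γ) ∂μ) = W at *
  generalize (∫ x, Real.exp ((f' x - k' x) / γ) ∂μ) = W' at *
  generalize Real.exp (L / γ) = t at *
  have hr : 1 ≤ t ^ 2 := one_le_pow₀ ht
  rw [add_div, Real.exp_add] at hratio
  have hem := Real.exp_pos (m / γ)
  have hed := Real.exp_pos (δ / γ)
  have hratio' : P * W' * (t ^ 2 + Real.exp (δ / γ)) ≤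
      P' * W * (t ^ 2 * Real.exp (δ / γ) + 1) := by
    refine le_of_mul_le_mul_left ?_ hem
    linarith
  have hlog := Real.log_le_log (by positivity) hratio'
  rw [Real.log_mul (by positivity) (by positivity), Real.log_mul hP.ne' hW'.ne',
    Real.log_mul (by positivity) (by positivity), Real.log_mul hP'.ne' hW.ne'] at hlog
  have hκ := log_mul_exp_add_one_sub_log_add_exp_le hr (div_nonneg hδ hγ.le)
  calc _ = γ * ((Real.log P - Real.log W) - (Real.log P' - Real.log W')) := by ring
    _ ≤ γ * ((t ^ 2 - 1) / (t ^ 2 + 1) * (δ / γ)) := by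
      gcongr
      linarith
    _ = _ := by field_simp

end Laplace

section BoundedLipschitz

variable {q : ℕ} {X : Set (EuclideanSpace ℝ (Fin q))} {α α' : Measure (EuclideanSpace ℝ (Fin q))}

theorem abs_integral_le_of_measure_compl_eq_zero [IsProbabilityMeasure α] (hα : α Xᶜ = 0)
    {ξ : EuclideanSpace ℝ (Fin q) → ℝ} {C : ℝ} (hξ : ∀ x ∈ X, |ξ x| ≤ C) :
    |∫ x, ξ x ∂α| ≤ C := by
  simpa using norm_integral_le_of_norm_le_const (μ := α) (f := ξ) (C := C)
    ((ae_mem_of_measure_compl_eq_zero hα).mono hξ)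

theorem abs_integral_sub_le_dblOn [IsProbabilityMeasure α] [IsProbabilityMeasure α']
    (hα : α Xᶜ = 0) (hα' : α' Xᶜ = 0) {ξ : EuclideanSpace ℝ (Fin q) → ℝ}
    (hξ : ∀ x ∈ X, |ξ x| ≤ 1) (hξ' : LipschitzOnWith 1 ξ X) :
    |(∫ x, ξ x ∂α) - ∫ x, ξ x ∂α'| ≤ dblOn X α α' := by
  refine le_csSup ⟨1 + 1, ?_⟩ ⟨ξ, hξ, hξ', rfl⟩
  rintro _ ⟨η, hη, -, rfl⟩
  exact (abs_sub _ _).trans (add_le_add (abs_integral_le_of_measure_compl_eq_zero hα hη)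
    (abs_integral_le_of_measure_compl_eq_zero hα' hη))

theorem dblOn_nonneg : 0 ≤ dblOn X α α' := by
  refine Real.sSup_nonneg ?_
  rintro _ ⟨η, -, -, rfl⟩
  exact abs_nonneg _

theorem abs_integral_sub_le_mul_dblOn [IsProbabilityMeasure α] [IsProbabilityMeasure α']
    (hα : α Xᶜ = 0) (hα' : α' Xᶜ = 0) {h : EuclideanSpace ℝ (Fin q) → ℝ} {K : ℝ} (hK : 0 < K)
    (hh : ∀ x ∈ X, |h x| ≤ K) (hh' : ∀ x ∈ X, ∀ y ∈ X, |h x - h y| ≤ K * ‖x - y‖) :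
    |(∫ x, h x ∂α) - ∫ x, h x ∂α'| ≤ K * dblOn X α α' := by
  have hscale := abs_integral_sub_le_dblOn hα hα' (ξ := fun x => h x / K)
    (fun x hx => by
      rw [abs_div, abs_of_pos hK, div_le_one hK]
      exact hh x hx)
    (LipschitzOnWith.of_dist_le_mul fun x hx y hy => by
      rw [Real.dist_eq, ← sub_div, abs_div, abs_of_pos hK, div_le_iff₀ hK, dist_eq_norm]
      simpa [mul_comm] using hh' x hx y hy)
  rwa [integral_div, integral_div, ← sub_div, abs_div, abs_of_pos hK, div_le_iff₀' hK] at hscale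

/-- Stability of `γ log ∫ exp (u / γ)` under a change of the measure. -/
theorem abs_log_integral_exp_sub_le_dblOn [IsProbabilityMeasure α] [IsProbabilityMeasure α']
    (hX : IsCompact X) (hα : α Xᶜ = 0) (hα' : α' Xᶜ = 0) {γ : ℝ} (hγ : 0 < γ)
    {u : EuclideanSpace ℝ (Fin q) → ℝ} (hu : ContinuousOn u X) {a b G : ℝ}
    (hau : ∀ x ∈ X, a ≤ u x) (hub : ∀ x ∈ X, u x ≤ b)
    (hG : ∀ x ∈ X, ∀ y ∈ X, |u x - u y| ≤ G * ‖x - y‖) :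
    |-γ * Real.log (∫ x, Real.exp (u x / γ) ∂α) - -γ * Real.log (∫ x, Real.exp (u x / γ) ∂α')| ≤
      γ * Real.exp (-a / γ) * (Real.exp (b / γ) * max 1 (G / γ)) * dblOn X α α' := by
  have lower (ν : Measure (EuclideanSpace ℝ (Fin q))) [IsProbabilityMeasure ν] (hν : ν Xᶜ = 0) :
      Real.exp (a / γ) ≤ ∫ x, Real.exp (u x / γ) ∂ν := by
    have h := integral_mono_ae (integrable_const (μ := ν) (Real.exp (a / γ)))
      ((continuousOn_exp_div hu).integrable_of_measure_compl_eq_zero hX hν)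
      ((ae_mem_of_measure_compl_eq_zero hν).mono fun x hx => by
        have := hau x hx
        dsimp only
        gcongr)
    simpa using h
  have hK : 0 < Real.exp (b / γ) * max 1 (G / γ) := by positivity
  have hint := abs_integral_sub_le_mul_dblOn hα hα' hK (h := fun x => Real.exp (u x / γ))
    (fun x hx => by
      have := hub x hx
      rw [abs_of_pos (Real.exp_pos _)]
      calc Real.exp (u x / γ) ≤ Real.exp (b / γ) * 1 := by rw [mul_one]; gcongr
        _ ≤ _ := by gcongr; exact le_max_left _ _)
    (fun x hx y hy => by
      have hx' := hub x hx
      have hy' := hub y hy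
      calc |Real.exp (u x / γ) - Real.exp (u y / γ)|
          ≤ Real.exp (b / γ) * |u x / γ - u y / γ| :=
            abs_exp_sub_exp_le (by gcongr) (by gcongr)
        _ = Real.exp (b / γ) * (|u x - u y| / γ) := by
            rw [← sub_div, abs_div, abs_of_pos hγ]
        _ ≤ Real.exp (b / γ) * (G * ‖x - y‖ / γ) := by
            have := hG x hx y hy
            gcongr
        _ = Real.exp (b / γ) * (G / γ) * ‖x - y‖ := by ring
        _ ≤ _ := by gcongr; exact le_max_right _ _)
  have hlog := abs_log_sub_log_le (Real.exp_pos (a / γ)) (lower α hα) (lower α' hα')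
  rw [← mul_sub, abs_mul, abs_neg, abs_of_pos hγ, neg_div, Real.exp_neg, mul_assoc, mul_assoc]
  gcongr
  exact hlog.trans (by gcongr)

end BoundedLipschitz

/-- **Lipschitz stability of the Sinkhorn potentials w.r.t. the first marginal.**
If `(f, g)` and `(f', g')` are Sinkhorn potential pairs for `(α, β)` and `(α', β)`,
normalized at a common point, then `‖f - f'‖∞ ≤ G_bl d_bl(α, α')` and
`‖g - g'‖∞ ≤ G_bl d_bl(α, α')` with the explicit constant `G_bl`. -/
theorem sinkhorn_potentials_stability
    {q : ℕ} (X : Set (EuclideanSpace ℝ (Fin q))) (hX : IsCompact X)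
    (γ : ℝ) (hγ : 0 < γ) (Mc Gc : ℝ)
    (c : EuclideanSpace ℝ (Fin q) → EuclideanSpace ℝ (Fin q) → ℝ)
    (hc_cont : ContinuousOn (fun p : EuclideanSpace ℝ (Fin q) × EuclideanSpace ℝ (Fin q) =>
      c p.1 p.2) (X ×ˢ X))
    (hc_bd : ∀ x ∈ X, ∀ y ∈ X, 0 ≤ c x y ∧ c x y ≤ Mc)
    (hc_lip1 : ∀ y ∈ X, ∀ x ∈ X, ∀ x' ∈ X, |c x y - c x' y| ≤ Gc * ‖x - x'‖)
    (hc_lip2 : ∀ x ∈ X, ∀ y ∈ X, ∀ y' ∈ X, |c x y - c x y'| ≤ Gc * ‖y - y'‖)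
    (α α' β : Measure (EuclideanSpace ℝ (Fin q)))
    [IsProbabilityMeasure α] [IsProbabilityMeasure α'] [IsProbabilityMeasure β]
    (hα : α Xᶜ = 0) (hα' : α' Xᶜ = 0) (hβ : β Xᶜ = 0)
    (f g f' g' : EuclideanSpace ℝ (Fin q) → ℝ)
    (hf_cont : ContinuousOn f X) (hg_cont : ContinuousOn g X)
    (hf'_cont : ContinuousOn f' X) (hg'_cont : ContinuousOn g' X)
    (hg_eq : ∀ y ∈ X, g y = sinkhornMap γ c f α y)
    (hf_eq : ∀ x ∈ X, f x = sinkhornMap γ c g β x)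
    (hg'_eq : ∀ y ∈ X, g' y = sinkhornMap γ c f' α' y)
    (hf'_eq : ∀ x ∈ X, f' x = sinkhornMap γ c g' β x)
    (x₀ : EuclideanSpace ℝ (Fin q)) (hx₀ : x₀ ∈ X)
    (hf₀ : f x₀ = 0) (hf'₀ : f' x₀ = 0)
    (lam Gbl : ℝ)
    (hlam : lam = (Real.exp (Mc / γ) - 1) / (Real.exp (Mc / γ) + 1))
    (hGbl : Gbl = 2 * γ * Real.exp (2 * Mc / γ) *
      max (Real.exp (3 * Mc / γ)) (2 * Gc * Real.exp (3 * Mc / γ) / γ) / (1 - lam ^ 2)) :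
    (∀ x ∈ X, |f x - f' x| ≤ Gbl * dblOn X α α') ∧
    (∀ x ∈ X, |g x - g' x| ≤ Gbl * dblOn X α α') := by
  have hM0 : 0 ≤ Mc := (hc_bd x₀ hx₀ x₀ hx₀).1.trans (hc_bd x₀ hx₀ x₀ hx₀).2
  have hc_left : ∀ y ∈ X, ContinuousOn (fun x => c x y) X := fun y hy =>
    hc_cont.comp (f := fun x => (x, y)) (by fun_prop) fun x hx => ⟨hx, hy⟩
  have hcc : ∀ y ∈ X, ∀ y' ∈ X, ∀ x ∈ X, |c x y - c x y'| ≤ Mc := fun y hy y' hy' x hx => by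
    have h₁ := hc_bd x hx y hy
    have h₂ := hc_bd x hx y' hy'
    rw [abs_le]
    constructor <;> linarith
  have hf'_sub {x y : EuclideanSpace ℝ (Fin q)} (hx : x ∈ X) (hy : y ∈ X) {s : ℝ}
      (hs : ∀ z ∈ X, |c z y - c z x| ≤ s) : |f' x - f' y| ≤ s := by
    rw [hf'_eq x hx, hf'_eq y hy]
    exact abs_log_integral_exp_sub_le hX hβ hγ (hg'_cont.sub (hc_left x hx))
      (hg'_cont.sub (hc_left y hy)) fun z hz => by simpa using hs z hz
  have hf'_abs : ∀ x ∈ X, |f' x| ≤ Mc := fun x hx => by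
    simpa [hf'₀] using hf'_sub hx hx₀ (hcc x₀ hx₀ x hx)
  have hf'_lip : ∀ x ∈ X, ∀ y ∈ X, |f' x - f' y| ≤ Gc * ‖x - y‖ := fun x hx y hy =>
    hf'_sub hx hy fun z hz => by simpa [norm_sub_rev] using hc_lip2 z hz y hy x hx
  set N : ℝ := γ * Real.exp (-(-(2 * Mc)) / γ) *
    (Real.exp (Mc / γ) * max 1 (2 * Gc / γ)) * dblOn X α α' with hN
  have hN0 : 0 ≤ N := mul_nonneg (by positivity) dblOn_nonneg
  have hmeas : ∀ y ∈ X, |sinkhornMap γ c f' α y - sinkhornMap γ c f' α' y| ≤ N := fun y hy =>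
    abs_log_integral_exp_sub_le_dblOn hX hα hα' hγ (hf'_cont.sub (hc_left y hy))
      (fun x hx => by
        have h₁ := (abs_le.1 (hf'_abs x hx)).1
        have h₂ := (hc_bd x hx y hy).2
        simp only [Pi.sub_apply]
        linarith)
      (fun x hx => by
        have h₁ := (abs_le.1 (hf'_abs x hx)).2
        have h₂ := (hc_bd x hx y hy).1
        simp only [Pi.sub_apply]
        linarith)
      (fun x hx x' hx' => by
        have h₁ := abs_le.1 (hf'_lip x hx x' hx')
        have h₂ := abs_le.1 (hc_lip1 y hy x hx x' hx')
        simp only [Pi.sub_apply]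
        rw [abs_le]
        constructor <;> linarith [h₁.1, h₁.2, h₂.1, h₂.2])
  obtain ⟨a, ha, hamin⟩ := hX.exists_isMinOn ⟨x₀, hx₀⟩ (hf_cont.sub hf'_cont)
  obtain ⟨b, hb, hbmax⟩ := hX.exists_isMaxOn ⟨x₀, hx₀⟩ (hf_cont.sub hf'_cont)
  obtain ⟨d, hd, hdmin⟩ := hX.exists_isMinOn ⟨x₀, hx₀⟩ (hg_cont.sub hg'_cont)
  simp only [isMinOn_iff, isMaxOn_iff, Pi.sub_apply] at hamin hbmax hdmin
  set δ : ℝ := (f b - f' b) - (f a - f' a) with hδ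
  have hδ0 : 0 ≤ δ := sub_nonneg.2 (hamin b hb)
  set κ : ℝ := (Real.exp (Mc / γ) ^ 2 - 1) / (Real.exp (Mc / γ) ^ 2 + 1) with hκ
  have ht : 1 ≤ Real.exp (Mc / γ) := Real.one_le_exp (by positivity)
  have hκ0 : 0 ≤ κ := div_nonneg (sub_nonneg.2 (one_le_pow₀ ht)) (by positivity)
  have hosc_g : ∀ y ∈ X, g y - g' y ≤ g d - g' d + (κ * δ + 2 * N) := fun y hy => by
    have h := log_integral_exp_sub_sub_le hX hα hγ hf_cont hf'_cont (hc_left d hd) (hc_left y hy)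
      hM0 hδ0 (hcc d hd y hy) hamin (fun x hx => by linarith [hbmax x hx])
    have h₁ := abs_le.1 (hmeas y hy)
    have h₂ := abs_le.1 (hmeas d hd)
    rw [hg_eq y hy, hg'_eq y hy, hg_eq d hd, hg'_eq d hd]
    simp only [sinkhornMap] at h₁ h₂ ⊢
    linarith [h₁.2, h₂.1]
  have hδ_le : δ ≤ κ * (κ * δ + 2 * N) := by
    have h := log_integral_exp_sub_sub_le hX hβ hγ hg_cont hg'_cont (hc_left a ha) (hc_left b hb)
      hM0 (by positivity) (hcc a ha b hb) hdmin hosc_g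
    have hfa := hf_eq a ha
    have hfb := hf_eq b hb
    have hfa' := hf'_eq a ha
    have hfb' := hf'_eq b hb
    simp only [sinkhornMap] at hfa hfb hfa' hfb'
    linarith
  have hf_le : ∀ x ∈ X, |f x - f' x| ≤ δ := fun x hx => by
    have h₁ := hamin x hx
    have h₂ := hbmax x hx
    have h₃ := hamin x₀ hx₀
    have h₄ := hbmax x₀ hx₀
    rw [abs_le]
    constructor <;> linarith
  have hg_le : ∀ y ∈ X, |g y - g' y| ≤ δ + N := fun y hy => by
    have h : |sinkhornMap γ c f α y - sinkhornMap γ c f' α y| ≤ δ :=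
      abs_log_integral_exp_sub_le hX hα hγ (hf_cont.sub (hc_left y hy))
        (hf'_cont.sub (hc_left y hy)) fun x hx => by simpa using hf_le x hx
    rw [hg_eq y hy, hg'_eq y hy]
    exact (abs_sub_le _ _ _).trans (add_le_add h (hmeas y hy))
  have hbound : δ + N ≤ Gbl * dblOn X α α' := by
    have hcoef := one_sub_sq_le_sq_mul_one_sub_sq ht
    rw [← hlam, ← hκ] at hcoef
    have hlam_pos : 0 < 1 - lam ^ 2 := by
      have : 1 - lam ^ 2 = 4 * Real.exp (Mc / γ) / (Real.exp (Mc / γ) + 1) ^ 2 := by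
        rw [hlam]
        field_simp
        ring
      rw [this]
      positivity
    have hGN : Gbl * dblOn X α α' =
        2 * N * Real.exp (Mc / γ) ^ 2 / (1 - lam ^ 2) := by
      have hmax : max (Real.exp (3 * Mc / γ)) (2 * Gc * Real.exp (3 * Mc / γ) / γ) =
          Real.exp (Mc / γ) ^ 3 * max 1 (2 * Gc / γ) := by
        rw [mul_max_of_nonneg _ _ (by positivity), ← Real.exp_nat_mul]
        congr 1
        · rw [mul_one]
          congr 1
          push_cast
          ring
        · rw [show 3 * Mc / γ = (3 : ℕ) * (Mc / γ) by push_cast; ring]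
          ring
      rw [hGbl, hmax, hN, neg_neg]
      ring
    rw [hGN, le_div_iff₀ hlam_pos]
    calc (δ + N) * (1 - lam ^ 2) ≤ (δ + N) * (Real.exp (Mc / γ) ^ 2 * (1 - κ ^ 2)) := by gcongr
      _ = Real.exp (Mc / γ) ^ 2 * ((δ + N) * (1 - κ ^ 2)) := by ring
      _ ≤ Real.exp (Mc / γ) ^ 2 * (2 * N) := by
        refine mul_le_mul_of_nonneg_left ?_ (by positivity)
        linarith [mul_nonneg hN0 (sq_nonneg (κ - 1))]
      _ = _ := by ring
  exact ⟨fun x hx => (hf_le x hx).trans ((le_add_of_nonneg_right hN0).trans hbound),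
    fun x hx => (hg_le x hx).trans hbound⟩
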